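/- Globally coarse STSs are decisive: let (S, Σ, κ) be a stochastic transition system and B ∈ Σ. If there exists a real number p > 0 such that for every state s ∈ S, either P_{δ_s}(F B) ≥ p or P_{δ_s}(F B) = 0, then the STS is decisive with respect to B. -/

import Mathlib

open MeasureTheory ProbabilityTheory Filter Set Topology

/-- Prepend one state to an infinite run. -/
def prep {S : Type*} (s : S) (ρ : ℕ → S) : ℕ → S
  | 0 => s
  | n + 1 => ρ n

/-- Prepend a finite word to an infinite run. -/
def prepList {S : Type*} (l : List S) (ρ : ℕ → S) : ℕ → S := fun n =>
  if h : n < l.length then l.get ⟨n, h⟩ else ρ (n - l.length)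

/-- `E` is a tail event: membership is not affected by changing a finite prefix. -/
def IsTailEvent {S : Type*} (E : Set (ℕ → S)) : Prop :=
  ∀ (l : List S) (ρ : ℕ → S), ρ ∈ E ↔ prepList l ρ ∈ E

/-- Cylinder `Cyl A n = {ρ | ρ k ∈ A k for all k < n}` (built from `A 0, …, A (n-1)`). -/
def Cyl {S : Type*} (A : ℕ → Set S) (n : ℕ) : Set (ℕ → S) := {ρ | ∀ k < n, ρ k ∈ A k}

/-- Event `F B`: eventually reach `B`. -/
def FEv {S : Type*} (B : Set S) : Set (ℕ → S) := {ρ | ∃ n, ρ n ∈ B}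

/-- Event `F^{≤ m} B`: reach `B` within `m` steps. -/
def FleEv {S : Type*} (m : ℕ) (B : Set S) : Set (ℕ → S) := {ρ | ∃ n ≤ m, ρ n ∈ B}

/-- Event `G B`: always in `B`. -/
def GEv {S : Type*} (B : Set S) : Set (ℕ → S) := {ρ | ∀ n, ρ n ∈ B}

/-- Event `GF B`: visit `B` infinitely often. -/
def GFEv {S : Type*} (B : Set S) : Set (ℕ → S) := {ρ | ∀ i, ∃ j ≥ i, ρ j ∈ B}

/-- Event `FG B`: eventually always in `B`. -/
def FGEv {S : Type*} (B : Set S) : Set (ℕ → S) := {ρ | ∃ i, ∀ j ≥ i, ρ j ∈ B}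

/-- Event `GF φ_𝒜`: the pattern `A 0, …, A n` occurs at infinitely many positions. -/
def GFPat {S : Type*} (A : ℕ → Set S) (n : ℕ) : Set (ℕ → S) :=
  {ρ | ∀ i, ∃ j ≥ i, ∀ k ≤ n, ρ (j + k) ∈ A k}

/-- Event `A U B`. -/
def UntilEv {S : Type*} (A B : Set S) : Set (ℕ → S) :=
  {ρ | ∃ n, ρ n ∈ B ∧ ∀ k < n, ρ k ∈ A}

/-- Event `A U^{≤ m} B`. -/
def UntilLeEv {S : Type*} (m : ℕ) (A B : Set S) : Set (ℕ → S) :=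
  {ρ | ∃ n ≤ m, ρ n ∈ B ∧ ∀ k < n, ρ k ∈ A}

/-- The filtration `F n`: σ-algebra generated by the cylinders of length `n`,
i.e., by the first `n` coordinates. -/
def cylFiltration (S : Type*) [MeasurableSpace S] (n : ℕ) : MeasurableSpace (ℕ → S) :=
  MeasurableSpace.comap (fun ρ (i : Fin n) => ρ i) inferInstance

/-- `P` is the family of path measures of the STS `(S, Σ, κ)` given by the
Ionescu–Tulcea construction: for every initial probability distribution `μ`,
`P μ` is a probability measure on runs, and `P` satisfies the Markov property
(`s₀ ∼ μ`, and the rest of the run follows the chain started in `κ s₀`),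
which uniquely characterizes the Ionescu–Tulcea path measures. -/
def IsPathMeasure {S : Type*} [MeasurableSpace S] (κ : Kernel S S)
    (P : Measure S → Measure (ℕ → S)) : Prop :=
  (∀ μ : Measure S, IsProbabilityMeasure μ → IsProbabilityMeasure (P μ)) ∧
  (∀ μ : Measure S, IsProbabilityMeasure μ →
    P μ = μ.bind fun s => (P (κ s)).map (prep s))

/-- `B̃`: the set of states from which `B` is reached with probability zero. -/
def Btilde {S : Type*} [MeasurableSpace S] (P : Measure S → Measure (ℕ → S)) (B : Set S) :
    Set S := {s | P (Measure.dirac s) (FEv B) = 0}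

/-- The STS with path measures `P` is decisive w.r.t. `B`. -/
def Decisive {S : Type*} [MeasurableSpace S] (P : Measure S → Measure (ℕ → S)) (B : Set S) :
    Prop := ∀ μ : Measure S, IsProbabilityMeasure μ → P μ (FEv B ∪ FEv (Btilde P B)) = 1

/-- `ν_{A₀,…,Aₙ}`: the distribution of the `n`-th state under `P ν` conditioned on
the cylinder `Cyl A (n+1)`. -/
noncomputable def condDist {S : Type*} [MeasurableSpace S]
    (P : Measure S → Measure (ℕ → S)) (ν : Measure S) (A : ℕ → Set S) (n : ℕ) : Measure S :=
  (ProbabilityTheory.cond (P ν) (Cyl A (n + 1))).map fun ρ => ρ n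

lemma measurable_prep {S : Type*} [MeasurableSpace S] (s : S) : Measurable (prep s) := by
  refine measurable_pi_lambda _ fun n => ?_
  cases n with
  | zero => exact measurable_const
  | succ n => exact measurable_pi_apply n

lemma preimage_prep_cyl_succ_of_mem {S : Type*} {A : Set S} {s : S} (hs : s ∈ A) (n : ℕ) :
    prep s ⁻¹' Cyl (fun _ => A) (n + 1) = Cyl (fun _ => A) n := by
  ext ρ
  simp only [Cyl, mem_preimage, mem_ofPred_eq]
  refine ⟨fun h k hk => h (k + 1) (by lia), fun h k hk => ?_⟩
  cases k with
  | zero => exact hs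
  | succ k => exact h k (by lia)

lemma preimage_prep_cyl_succ_of_notMem {S : Type*} {A : Set S} {s : S} (hs : s ∉ A) (n : ℕ) :
    prep s ⁻¹' Cyl (fun _ => A) (n + 1) = ∅ :=
  eq_empty_of_forall_notMem fun _ h => hs (h 0 n.succ_pos)

lemma measurableSet_cyl_const {S : Type*} [MeasurableSpace S] {A : Set S}
    (hA : MeasurableSet A) (n : ℕ) : MeasurableSet (Cyl (fun _ => A) n) := by
  have : Cyl (fun _ => A) n = ⋂ k, ⋂ (_ : k < n), (fun ρ : ℕ → S => ρ k) ⁻¹' A := by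
    ext ρ
    simp [Cyl]
  rw [this]
  exact .iInter fun k => .iInter fun _ => measurable_pi_apply k hA

lemma GEv_eq_iInter_cyl {S : Type*} (A : Set S) : GEv A = ⋂ n, Cyl (fun _ => A) n := by
  ext ρ
  simp only [GEv, Cyl, mem_iInter, mem_ofPred_eq]
  exact ⟨fun h _ k _ => h k, fun h n => h (n + 1) n n.lt_succ_self⟩

lemma measurableSet_GEv {S : Type*} [MeasurableSpace S] {A : Set S} (hA : MeasurableSet A) :
    MeasurableSet (GEv A) := by
  rw [GEv_eq_iInter_cyl]
  exact .iInter fun n => measurableSet_cyl_const hA n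

lemma FEv_eq_compl_GEv {S : Type*} (B : Set S) : FEv B = (GEv Bᶜ)ᶜ := by
  ext ρ
  simp [FEv, GEv]

/-- The Markov property, evaluated on a measurable event. -/
lemma IsPathMeasure.apply_eq_lintegral {S : Type*} [MeasurableSpace S] {κ : Kernel S S}
    {P : Measure S → Measure (ℕ → S)} (hP : IsPathMeasure κ P) (μ : Measure S)
    [hμ : IsProbabilityMeasure μ] {E : Set (ℕ → S)} (hE : MeasurableSet E) :
    P μ E = ∫⁻ s, P (κ s) (prep s ⁻¹' E) ∂μ := by
  have hprob := hP.1 μ hμ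
  have hae : AEMeasurable (fun s => (P (κ s)).map (prep s)) μ := by
    by_contra h
    have hzero : P μ = 0 := by
      rw [hP.2 μ hμ, Measure.bind, Measure.map_of_not_aemeasurable h, Measure.join_zero]
    exact IsProbabilityMeasure.ne_zero (P μ) hzero
  rw [hP.2 μ hμ, Measure.bind_apply hE hae]
  simp_rw [Measure.map_apply (measurable_prep _) hE]

/-- The probability that the first `n` states of the chain started in `s` lie in `A`. -/
noncomputable def stayProb {S : Type*} [MeasurableSpace S] (κ : Kernel S S) (A : Set S) :
    ℕ → S → ENNReal
  | 0 => 1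
  | n + 1 => A.indicator fun s => ∫⁻ t, stayProb κ A n t ∂(κ s)

lemma measurable_stayProb {S : Type*} [MeasurableSpace S] (κ : Kernel S S) {A : Set S}
    (hA : MeasurableSet A) (n : ℕ) : Measurable (stayProb κ A n) := by
  induction n with
  | zero => exact measurable_one
  | succ n ih => exact ih.lintegral_kernel.indicator hA

lemma antitone_stayProb {S : Type*} [MeasurableSpace S] (κ : Kernel S S) [IsMarkovKernel κ]
    (A : Set S) : Antitone (stayProb κ A) := by
  refine antitone_nat_of_succ_le fun n => ?_
  induction n with
  | zero =>
    intro s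
    refine (indicator_le_self _ _ s).trans ?_
    simp [stayProb]
  | succ n ih => exact fun s => indicator_le_indicator (lintegral_mono ih)

lemma stayProb_mono_set {S : Type*} [MeasurableSpace S] (κ : Kernel S S) {A A' : Set S}
    (h : A ⊆ A') (n : ℕ) : stayProb κ A n ≤ stayProb κ A' n := by
  induction n with
  | zero => exact le_rfl
  | succ n ih =>
    intro s
    refine (indicator_le_indicator_of_subset h (fun _ => zero_le) s).trans ?_
    exact indicator_le_indicator (lintegral_mono ih)

lemma lintegral_iInf_stayProb {S : Type*} [MeasurableSpace S] (κ : Kernel S S)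
    [IsMarkovKernel κ] {A : Set S} (hA : MeasurableSet A) (μ : Measure S)
    [IsProbabilityMeasure μ] :
    ∫⁻ s, ⨅ n, stayProb κ A n s ∂μ = ⨅ n, ∫⁻ s, stayProb κ A n s ∂μ :=
  lintegral_iInf (measurable_stayProb κ hA) (antitone_stayProb κ A) (by simp [stayProb])

lemma IsPathMeasure.apply_cyl_const {S : Type*} [MeasurableSpace S] {κ : Kernel S S}
    [IsMarkovKernel κ] {P : Measure S → Measure (ℕ → S)} (hP : IsPathMeasure κ P) {A : Set S}
    (hA : MeasurableSet A) (n : ℕ) (μ : Measure S) [hμ : IsProbabilityMeasure μ] :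
    P μ (Cyl (fun _ => A) n) = ∫⁻ s, stayProb κ A n s ∂μ := by
  induction n generalizing μ with
  | zero =>
    have := hP.1 μ hμ
    simp [Cyl, stayProb]
  | succ n ih =>
    rw [hP.apply_eq_lintegral μ (measurableSet_cyl_const hA _)]
    refine lintegral_congr fun s => ?_
    by_cases hs : s ∈ A
    · rw [preimage_prep_cyl_succ_of_mem hs, ih (κ s), stayProb, indicator_of_mem hs]
    · rw [preimage_prep_cyl_succ_of_notMem hs, measure_empty, stayProb, indicator_of_notMem hs]

lemma IsPathMeasure.apply_GEv {S : Type*} [MeasurableSpace S] {κ : Kernel S S}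
    [IsMarkovKernel κ] {P : Measure S → Measure (ℕ → S)} (hP : IsPathMeasure κ P) {A : Set S}
    (hA : MeasurableSet A) (μ : Measure S) [hμ : IsProbabilityMeasure μ] :
    P μ (GEv A) = ∫⁻ s, ⨅ n, stayProb κ A n s ∂μ := by
  have := hP.1 μ hμ
  have hanti : Antitone fun n => Cyl (fun _ => A) n :=
    fun m n hmn ρ hρ k hk => hρ k (hk.trans_le hmn)
  rw [GEv_eq_iInter_cyl, hanti.measure_iInter
    (fun n => (measurableSet_cyl_const hA n).nullMeasurableSet) ⟨0, measure_ne_top _ _⟩,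
    lintegral_iInf_stayProb κ hA]
  simp_rw [hP.apply_cyl_const hA]

/-- If the probability of staying in `A` forever is bounded away from `1`, then it vanishes. -/
lemma iInf_stayProb_eq_zero {S : Type*} [MeasurableSpace S] (κ : Kernel S S)
    [IsMarkovKernel κ] {A : Set S} (hA : MeasurableSet A) {c : ENNReal} (hc : c < 1)
    (h : ∀ s ∈ A, ⨅ n, stayProb κ A n s ≤ c) (s : S) : ⨅ n, stayProb κ A n s = 0 := by
  have hstep (s : S) : ⨅ n, stayProb κ A n s ≤
      A.indicator (fun s => ∫⁻ t, ⨅ n, stayProb κ A n t ∂(κ s)) s := by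
    by_cases hs : s ∈ A
    · rw [indicator_of_mem hs, lintegral_iInf_stayProb κ hA]
      refine le_iInf fun n => (iInf_le _ (n + 1)).trans ?_
      rw [stayProb, indicator_of_mem hs]
    · rw [indicator_of_notMem hs]
      refine (iInf_le _ 1).trans ?_
      rw [stayProb, indicator_of_notMem hs]
  have hbound (n : ℕ) (s : S) : ⨅ m, stayProb κ A m s ≤ c * stayProb κ A n s := by
    induction n generalizing s with
    | zero =>
      by_cases hs : s ∈ A
      · simpa [stayProb] using h s hs
      · exact (hstep s).trans (by simp [hs])
    | succ n ih =>
      refine (hstep s).trans ?_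
      by_cases hs : s ∈ A
      · rw [stayProb, indicator_of_mem hs, indicator_of_mem hs,
          ← lintegral_const_mul _ (measurable_stayProb κ hA n)]
        exact lintegral_mono ih
      · simp [hs]
  have hfix : ⨅ n, stayProb κ A n s ≤ c * ⨅ n, stayProb κ A n s := by
    rw [ENNReal.mul_iInf (fun h => absurd h hc.ne_top)]
    exact le_iInf fun n => hbound n s
  have hne_top : ⨅ n, stayProb κ A n s ≠ ⊤ :=
    ((iInf_le _ 0).trans_lt (by simp [stayProb])).ne
  by_contra hne
  exact (hfix.trans_lt ((ENNReal.mul_lt_mul_iff_left hne hne_top).2 hc)).ne (one_mul _).symm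

lemma measurable_iInf_stayProb {S : Type*} [MeasurableSpace S] (κ : Kernel S S) {A : Set S}
    (hA : MeasurableSet A) : Measurable fun s => ⨅ n, stayProb κ A n s :=
  .iInf fun n => measurable_stayProb κ hA n

lemma IsPathMeasure.dirac_FEv {S : Type*} [MeasurableSpace S] {κ : Kernel S S}
    [IsMarkovKernel κ] {P : Measure S → Measure (ℕ → S)} (hP : IsPathMeasure κ P) {B : Set S}
    (hB : MeasurableSet B) (s : S) :
    P (Measure.dirac s) (FEv B) = 1 - ⨅ n, stayProb κ Bᶜ n s := by
  have := hP.1 (Measure.dirac s) inferInstance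
  rw [FEv_eq_compl_GEv, prob_compl_eq_one_sub (measurableSet_GEv hB.compl),
    hP.apply_GEv hB.compl, lintegral_dirac' _ (measurable_iInf_stayProb κ hB.compl)]

lemma IsPathMeasure.measurableSet_Btilde {S : Type*} [MeasurableSpace S] {κ : Kernel S S}
    [IsMarkovKernel κ] {P : Measure S → Measure (ℕ → S)} (hP : IsPathMeasure κ P) {B : Set S}
    (hB : MeasurableSet B) : MeasurableSet (Btilde P B) := by
  simp_rw [Btilde, hP.dirac_FEv hB]
  exact (measurable_const.sub (measurable_iInf_stayProb κ hB.compl)) (measurableSet_singleton 0)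

/-- **Globally coarse STSs are decisive.** If there is `p > 0` such that from every state
`s`, either `P_{δ_s}(F B) ≥ p` or `P_{δ_s}(F B) = 0`, then the STS is decisive w.r.t. `B`. -/
theorem globally_coarse_decisive
    {S : Type*} [MeasurableSpace S] (κ : Kernel S S) [IsMarkovKernel κ]
    (P : Measure S → Measure (ℕ → S)) (hP : IsPathMeasure κ P)
    (B : Set S) (hB : MeasurableSet B)
    (p : ℝ) (hp : 0 < p)
    (hcoarse : ∀ s : S,
      ENNReal.ofReal p ≤ P (Measure.dirac s) (FEv B) ∨ P (Measure.dirac s) (FEv B) = 0) :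
    Decisive P B := by
  intro μ hμ
  have := hP.1 μ hμ
  have hmeas : MeasurableSet (B ∪ Btilde P B) := hB.union (hP.measurableSet_Btilde hB)
  have hunion : FEv B ∪ FEv (Btilde P B) = (GEv (B ∪ Btilde P B)ᶜ)ᶜ := by
    rw [← FEv_eq_compl_GEv]
    ext ρ
    simp [FEv, exists_or]
  have hc : 1 - ENNReal.ofReal p < 1 :=
    ENNReal.sub_lt_self ENNReal.one_ne_top one_ne_zero (by simpa using hp)
  have hstay : ∀ s ∈ (B ∪ Btilde P B)ᶜ,
      ⨅ n, stayProb κ (B ∪ Btilde P B)ᶜ n s ≤ 1 - ENNReal.ofReal p := by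
    intro s hs
    have hle : ENNReal.ofReal p ≤ 1 - ⨅ n, stayProb κ Bᶜ n s := by
      rw [← hP.dirac_FEv hB]
      exact (hcoarse s).resolve_right fun h => hs (Or.inr h)
    have hone : ⨅ n, stayProb κ Bᶜ n s ≤ 1 := iInf_le _ 0
    refine (iInf_mono fun n =>
      stayProb_mono_set κ (compl_subset_compl.2 subset_union_left) n s).trans ?_
    rw [← ENNReal.sub_sub_cancel ENNReal.one_ne_top hone]
    exact tsub_le_tsub_left hle 1
  rw [hunion, prob_compl_eq_one_iff (measurableSet_GEv hmeas.compl), hP.apply_GEv hmeas.compl]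
  simp_rw [iInf_stayProb_eq_zero κ hmeas.compl hc hstay, lintegral_zero]
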